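/- arXiv:2009.13976 — 2 statements merged into one kernel-verified Lean document; each statement's English description precedes it below -/
import Mathlib

section
/- Let n ≥ 3 and let η_0 ≥ 1, η_1 ≥ 0, η_2 ≥ 0 be integers with η_1 + η_2 ≥ 1, and let a = (a_1,…,a_n) ∈ ℝ^n be nonzero. Then there exists a constant C > 0 such that for every integer k ≥ 2(n−1) + (η_1+η_2)/η_0 and every λ = (λ_1,…,λ_n) ∈ ℝ^n with λ_1 ≥ λ_2 ≥ ⋯ ≥ λ_n ≥ 0, one has ( ∏_{i<j, a_i ≠ a_j} (1+λ_i−λ_j)^{−η_0 k} · ∏_{i<j, a_i ≠ −a_j} (1+λ_i+λ_j)^{−η_0 k} · ∏_{i : a_i ≠ 0} (1+λ_i)^{−η_1 k}(1+2λ_i)^{−η_2 k} ) · ∏_{i<j} [(1+λ_i−λ_j)(1+λ_i+λ_j)]^{η_0} · ∏_{i=1}^n (1+λ_i)^{η_1}(1+2λ_i)^{η_2} ≤ C · min(1, ‖λ‖^{η_0(2(n−1)−k) + η_1 + η_2}), where ‖·‖ is the Euclidean norm. -/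
/-- The contribution of the roots `e_i - e_j` and `e_i + e_j` not annihilating `a`, where
`a`, `b` are the coordinates of `a` and `x`, `y` those of `λ`, each root being weighted by the
value of `L` at the absolute value of the root on `λ`. -/
noncomputable def rootPairWeight (L : ℝ → ℝ) (a b x y : ℝ) : ℝ :=
  (if a ≠ b then L |x - y| else 0) + (if a ≠ -b then L (x + y) else 0)

lemma rootPairWeight_comm (L : ℝ → ℝ) (a b x y : ℝ) :
    rootPairWeight L a b x y = rootPairWeight L b a y x := by
  have h : a = -b ↔ b = -a := by constructor <;> intro h <;> linarith
  simp only [rootPairWeight, ne_eq, abs_sub_comm x y, add_comm x y, eq_comm (a := a) (b := b), h]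

lemma rootPairWeight_nonneg {L : ℝ → ℝ} (h0 : ∀ t, 0 ≤ t → 0 ≤ L t) (a b : ℝ) {x y : ℝ}
    (hx : 0 ≤ x) (hy : 0 ≤ y) : 0 ≤ rootPairWeight L a b x y := by
  have h1 := h0 _ (abs_nonneg (x - y))
  have h2 := h0 _ (add_nonneg hx hy)
  unfold rootPairWeight
  split_ifs <;> linarith

lemma rootPairWeight_le {L : ℝ → ℝ} (h0 : ∀ t, 0 ≤ t → 0 ≤ L t) (a b : ℝ) {x y : ℝ}
    (hx : 0 ≤ x) (hy : 0 ≤ y) : rootPairWeight L a b x y ≤ L |x - y| + L (x + y) := by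
  have h1 := h0 _ (abs_nonneg (x - y))
  have h2 := h0 _ (add_nonneg hx hy)
  unfold rootPairWeight
  split_ifs <;> linarith

/-- In rank three, the roots not annihilating a nonzero vector carry at least a third of the total
weight, for every monotone subadditive weight. -/
lemma weight_triple_le {L : ℝ → ℝ} (h0 : ∀ t, 0 ≤ t → 0 ≤ L t)
    (hL : ∀ s t u, 0 ≤ s → 0 ≤ t → 0 ≤ u → u ≤ s + t → L u ≤ L s + L t)
    (hm : ∀ s t, 0 ≤ s → s ≤ t → L s ≤ L t)
    {a b c x y z : ℝ} (hc : c ≠ 0) (hx : 0 ≤ x) (hy : 0 ≤ y) (hz : 0 ≤ z) :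
    (L |x - y| + L (x + y)) + (L |x - z| + L (x + z)) + (L |y - z| + L (y + z)) ≤
      3 * (rootPairWeight L a b x y + rootPairWeight L a c x z + rootPairWeight L b c y z) := by
  have px := abs_nonneg (x - y)
  have py := abs_nonneg (x - z)
  have pz := abs_nonneg (y - z)
  have qx : 0 ≤ x + y := by linarith
  have qy : 0 ≤ x + z := by linarith
  have qz : 0 ≤ y + z := by linarith
  have d1 : |x - y| ≤ x + y := abs_le.2 ⟨by linarith, by linarith⟩
  have d2 : |x - z| ≤ x + z := abs_le.2 ⟨by linarith, by linarith⟩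
  have d3 : |y - z| ≤ y + z := abs_le.2 ⟨by linarith, by linarith⟩
  have t1 : |x - y| ≤ |x - z| + |y - z| := by rw [abs_sub_comm y z]; exact abs_sub_le x z y
  have t2 : |x - z| ≤ |x - y| + |y - z| := abs_sub_le x y z
  have t3 : |y - z| ≤ |x - y| + |x - z| := by rw [abs_sub_comm x y]; exact abs_sub_le y x z
  have a1 := le_abs_self (x - y)
  have a2 := le_abs_self (x - z)
  have a3 := le_abs_self (y - z)
  have b1 := neg_abs_le (x - y)
  have b2 := neg_abs_le (x - z)
  have b3 := neg_abs_le (y - z)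
  have e1 := hL _ _ _ py pz px t1
  have e2 := hL _ _ _ px pz py t2
  have e3 := hL _ _ _ px py pz t3
  have f1 := hL _ _ _ py qz qx (by linarith)
  have f2 := hL _ _ _ pz qy qx (by linarith)
  have f3 := hL _ _ _ px qz qy (by linarith)
  have f4 := hL _ _ _ pz qx qy (by linarith)
  have f5 := hL _ _ _ px qy qz (by linarith)
  have f6 := hL _ _ _ py qx qz (by linarith)
  have g1 := hm _ _ px d1
  have g2 := hm _ _ py d2
  have g3 := hm _ _ pz d3
  have n1 := h0 _ px
  have n2 := h0 _ py
  have n3 := h0 _ pz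
  simp only [rootPairWeight, ne_eq]
  clear h0 hL hm px py pz qx qy qz d1 d2 d3 t1 t2 t3 a1 a2 a3 b1 b2 b3
  generalize L |x - y| = A at *
  generalize L |x - z| = B at *
  generalize L |y - z| = D at *
  generalize L (x + y) = S at *
  generalize L (x + z) = T at *
  generalize L (y + z) = U at *
  split_ifs <;> first | linarith | (exfalso; grind)

lemma two_mul_le_rootPairWeight_id_triple {a b c x y z : ℝ} (h : a ≠ 0 ∨ b ≠ 0 ∨ c ≠ 0)
    (hx : 0 ≤ x) (hy : 0 ≤ y) (hz : 0 ≤ z) :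
    2 * x ≤ rootPairWeight id a b x y + rootPairWeight id a c x z + rootPairWeight id b c y z := by
  have t1 : |x - y| ≤ |x - z| + |y - z| := by rw [abs_sub_comm y z]; exact abs_sub_le x z y
  have t2 : |x - z| ≤ |x - y| + |y - z| := abs_sub_le x y z
  have a1 := le_abs_self (x - y)
  have a2 := le_abs_self (x - z)
  have n3 := abs_nonneg (y - z)
  have n1 := abs_nonneg (x - y)
  have n2 := abs_nonneg (x - z)
  simp only [rootPairWeight, ne_eq, id]
  generalize |x - y| = A at *
  generalize |x - z| = B at *
  generalize |y - z| = D at *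
  split_ifs <;> first | linarith | (exfalso; grind)

/-- Averaging over the triangles through a vertex `p`. -/
lemma sum_pairs_add_star_nonneg {n : ℕ} (hn : 3 ≤ n) (p : Fin n) (F : Fin n → Fin n → ℝ)
    (hF : ∀ i j, F i j = F j i)
    (h : ∀ i j, i ≠ p → j ≠ p → i ≠ j → 0 ≤ F i j + F i p + F j p) :
    0 ≤ ∑ q ∈ Finset.univ.filter (fun q : Fin n × Fin n => q.1 < q.2), F q.1 q.2
      + ((n : ℝ) - 3) * ∑ i ∈ Finset.univ.erase p, F i p := by
  set s : Finset (Fin n) := Finset.univ.erase p with hs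
  have hcard : (s.card : ℝ) = n - 1 := by
    rw [hs, Finset.card_erase_of_mem (Finset.mem_univ p), Finset.card_univ, Fintype.card_fin,
      Nat.cast_sub (by omega)]
    simp
  let G : Fin n → Fin n → ℝ := fun i j => if i = j then 0 else F i j
  have hG : ∑ i, ∑ j, G i j
      = 2 * ∑ q ∈ Finset.univ.filter (fun q : Fin n × Fin n => q.1 < q.2), F q.1 q.2 := by
    have hsw : ∑ q : Fin n × Fin n, (if q.2 < q.1 then F q.1 q.2 else 0)
        = ∑ q : Fin n × Fin n, (if q.1 < q.2 then F q.1 q.2 else 0) :=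
      Fintype.sum_equiv (Equiv.prodComm _ _) _ _ (fun q => by rw [hF q.1 q.2]; rfl)
    rw [← Fintype.sum_prod_type', Finset.sum_filter, two_mul]
    nth_rewrite 1 [← hsw]
    rw [← Finset.sum_add_distrib]
    refine Finset.sum_congr rfl fun q _ => ?_
    rcases lt_trichotomy q.1 q.2 with hq | hq | hq
    · simp [G, hq, hq.ne, hq.not_gt]
    · simp [G, hq]
    · simp [G, hq, hq.ne', hq.not_gt]
  have hsplit : ∑ i, ∑ j, G i j = ∑ i ∈ s, ∑ j ∈ s, G i j + 2 * ∑ i ∈ s, F i p := by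
    have e (f : Fin n → ℝ) : ∑ i, f i = ∑ i ∈ s, f i + f p :=
      (Finset.sum_erase_add _ _ (Finset.mem_univ p)).symm
    have e1 : ∑ i ∈ s, G i p = ∑ i ∈ s, F i p :=
      Finset.sum_congr rfl fun i hi => if_neg (Finset.ne_of_mem_erase hi)
    have e2 : ∑ i ∈ s, G p i = ∑ i ∈ s, F i p :=
      Finset.sum_congr rfl fun i hi => by
        rw [hF i p]; exact if_neg (Finset.ne_of_mem_erase hi).symm
    have e3 : G p p = 0 := if_pos rfl
    simp only [e, Finset.sum_add_distrib, e1, e2, e3]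
    ring
  have key : 0 ≤ ∑ i ∈ s, ∑ j ∈ s, (G i j + ((F i p + F j p) - if i = j then 2 * F i p else 0)) := by
    refine Finset.sum_nonneg fun i hi => Finset.sum_nonneg fun j hj => ?_
    by_cases hij : i = j
    · subst hij
      simp [G, two_mul]
    · have := h i j (Finset.ne_of_mem_erase hi) (Finset.ne_of_mem_erase hj) hij
      simp only [G, if_neg hij]
      linarith
  have hstar : ∑ i ∈ s, ∑ j ∈ s, ((F i p + F j p) - if i = j then 2 * F i p else 0)
      = 2 * ((n : ℝ) - 2) * ∑ i ∈ s, F i p := by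
    simp only [Finset.sum_sub_distrib, Finset.sum_add_distrib, Finset.sum_const, nsmul_eq_mul,
      ← Finset.mul_sum, Finset.sum_ite_eq, hcard]
    rw [Finset.sum_congr rfl (fun i hi => if_pos hi), ← Finset.mul_sum]
    ring
  simp only [Finset.sum_add_distrib (f := fun j => G _ j)] at key
  rw [Finset.sum_add_distrib, hstar] at key
  linarith

lemma sum_star_le_sum_pairs {n : ℕ} (p : Fin n) (F : Fin n → Fin n → ℝ)
    (hF : ∀ i j, F i j = F j i) (h : ∀ i j, 0 ≤ F i j) :
    ∑ i ∈ Finset.univ.erase p, F i p ≤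
      ∑ q ∈ Finset.univ.filter (fun q : Fin n × Fin n => q.1 < q.2), F q.1 q.2 := by
  have hinj : Set.InjOn (fun i : Fin n => (min i p, max i p)) (Finset.univ.erase p : Finset _) := by
    intro i hi j hj hij
    simp only [Prod.mk.injEq] at hij
    grind
  calc ∑ i ∈ Finset.univ.erase p, F i p
      = ∑ q ∈ (Finset.univ.erase p).image (fun i : Fin n => (min i p, max i p)), F q.1 q.2 := by
        rw [Finset.sum_image hinj]
        refine Finset.sum_congr rfl fun i _ => ?_
        rcases le_total i p with hi | hi
        · simp [hi]
        · simp [hi, hF i p]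
    _ ≤ _ := by
        refine Finset.sum_le_sum_of_subset_of_nonneg ?_ fun _ _ _ => h _ _
        intro q hq
        obtain ⟨i, hi, rfl⟩ := Finset.mem_image.1 hq
        simpa using (Finset.ne_of_mem_erase hi).symm

lemma single_triangle_le_sum_pairs {n : ℕ} (F : Fin n → Fin n → ℝ)
    (hF : ∀ i j, F i j = F j i) (h : ∀ i j, 0 ≤ F i j) {i j k : Fin n} (hij : i ≠ j)
    (hik : i ≠ k) (hjk : j ≠ k) :
    F i j + F i k + F j k ≤
      ∑ q ∈ Finset.univ.filter (fun q : Fin n × Fin n => q.1 < q.2), F q.1 q.2 := by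
  have hm (i j : Fin n) : F (min i j) (max i j) = F i j := by
    rcases le_total i j with hi | hi
    · simp [hi]
    · simp [hi, hF i j]
  calc F i j + F i k + F j k
      = ∑ q ∈ ({(min i j, max i j), (min i k, max i k), (min j k, max j k)} :
          Finset (Fin n × Fin n)), F q.1 q.2 := by
        rw [Finset.sum_insert, Finset.sum_insert, Finset.sum_singleton]
        · simp only [hm, add_assoc]
        · simp only [Finset.mem_singleton, Prod.mk.injEq]; grind
        · simp only [Finset.mem_insert, Finset.mem_singleton, Prod.mk.injEq]; grind
    _ ≤ _ := by
        refine Finset.sum_le_sum_of_subset_of_nonneg ?_ fun _ _ _ => h _ _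
        intro q hq
        simp only [Finset.mem_insert, Finset.mem_singleton] at hq
        rcases hq with rfl | rfl | rfl
        · simpa using hij.symm
        · simpa using hik.symm
        · simpa using hjk.symm

/-- The pairs `i < j` weighted by the long roots not annihilating `a`. -/
noncomputable def rootWeight {n : ℕ} (L : ℝ → ℝ) (a l : Fin n → ℝ) : ℝ :=
  ∑ q ∈ Finset.univ.filter (fun q : Fin n × Fin n => q.1 < q.2),
    rootPairWeight L (a q.1) (a q.2) (l q.1) (l q.2)

section Weights

variable {n : ℕ} {a l : Fin n → ℝ} {p : Fin n} {L : ℝ → ℝ}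

lemma total_le_rootWeight (hn : 3 ≤ n) (h0 : ∀ t, 0 ≤ t → 0 ≤ L t)
    (hL : ∀ s t u, 0 ≤ s → 0 ≤ t → 0 ≤ u → u ≤ s + t → L u ≤ L s + L t)
    (hm : ∀ s t, 0 ≤ s → s ≤ t → L s ≤ L t) (hp : a p ≠ 0) (hl : ∀ i, 0 ≤ l i) :
    ∑ q ∈ Finset.univ.filter (fun q : Fin n × Fin n => q.1 < q.2),
      (L |l q.1 - l q.2| + L (l q.1 + l q.2)) ≤ (2 * (n : ℝ) - 3) * rootWeight L a l := by
  have hn' : (3 : ℝ) ≤ n := by exact_mod_cast hn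
  let g : Fin n → Fin n → ℝ := fun i j => rootPairWeight L (a i) (a j) (l i) (l j)
  let w : Fin n → Fin n → ℝ := fun i j => L |l i - l j| + L (l i + l j)
  have hg : ∀ i j, g i j = g j i := fun i j => rootPairWeight_comm _ _ _ _ _
  have hw : ∀ i j, w i j = w j i := fun i j => by
    simp only [w, abs_sub_comm (l i), add_comm (l i)]
  have key := sum_pairs_add_star_nonneg hn p (fun i j => 3 * g i j - w i j)
    (fun i j => by rw [hg i j, hw i j]) (fun i j _ _ _ => by
      have := weight_triple_le h0 hL hm (a := a i) (b := a j) hp (hl i) (hl j) (hl p)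
      simp only [g, w]
      linarith)
  have hle : ∑ i ∈ Finset.univ.erase p, (3 * g i p - w i p) ≤ 2 * rootWeight L a l := by
    refine le_trans ?_ (mul_le_mul_of_nonneg_left (sum_star_le_sum_pairs p g hg
      (fun i j => rootPairWeight_nonneg h0 _ _ (hl i) (hl j))) (by norm_num))
    rw [Finset.mul_sum]
    refine Finset.sum_le_sum fun i _ => ?_
    have := rootPairWeight_le h0 (a i) (a p) (hl i) (hl p)
    simp only [g, w]
    linarith
  have hle' := mul_le_mul_of_nonneg_left hle (by linarith : (0 : ℝ) ≤ n - 3)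
  rw [Finset.sum_sub_distrib, ← Finset.mul_sum] at key
  simp only [rootWeight, g, w] at *
  linarith

lemma sum_zero_le_rootWeight (h0 : ∀ t, 0 ≤ t → 0 ≤ L t)
    (hL : ∀ s t u, 0 ≤ s → 0 ≤ t → 0 ≤ u → u ≤ s + t → L u ≤ L s + L t)
    (hp : a p ≠ 0) (hl : ∀ i, 0 ≤ l i) :
    ∑ i ∈ Finset.univ.filter (fun i => ¬ a i ≠ 0), L (2 * l i) ≤ rootWeight L a l := by
  have hnn : ∀ i j, 0 ≤ rootPairWeight L (a i) (a j) (l i) (l j) :=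
    fun i j => rootPairWeight_nonneg h0 _ _ (hl i) (hl j)
  refine le_trans ?_ (sum_star_le_sum_pairs p
    (fun i j => rootPairWeight L (a i) (a j) (l i) (l j))
    (fun i j => rootPairWeight_comm _ _ _ _ _) hnn)
  refine (Finset.sum_le_sum fun i hi => ?_).trans
    (Finset.sum_le_sum_of_subset_of_nonneg (t := Finset.univ.erase p) ?_ fun i _ _ => hnn i p)
  · have hi0 : a i = 0 := by simpa using hi
    have h1 : (0 : ℝ) ≠ a p := hp.symm
    have h2 : (0 : ℝ) ≠ -a p := (neg_ne_zero.2 hp).symm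
    simp only [rootPairWeight, hi0, if_pos h1, if_pos h2]
    have := le_abs_self (l i - l p)
    exact hL _ _ _ (abs_nonneg _) (add_nonneg (hl i) (hl p)) (by linarith [hl i]) (by linarith)
  · intro i hi
    have hi0 : a i = 0 := by simpa using hi
    refine Finset.mem_erase.2 ⟨?_, Finset.mem_univ i⟩
    rintro rfl
    exact hp hi0

lemma norm_le_rootWeight_id (hn : 3 ≤ n) {a : Fin n → ℝ} (hp : a p ≠ 0)
    (l : EuclideanSpace ℝ (Fin n)) (hl : ∀ i, 0 ≤ l i) : ‖l‖ ≤ rootWeight id a l := by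
  have hn' : (3 : ℝ) ≤ n := by exact_mod_cast hn
  let g : Fin n → Fin n → ℝ := fun i j => rootPairWeight id (a i) (a j) (l i) (l j)
  have hg : ∀ i j, g i j = g j i := fun i j => rootPairWeight_comm _ _ _ _ _
  have hg0 : ∀ i j, 0 ≤ g i j :=
    fun i j => rootPairWeight_nonneg (fun t ht => ht) _ _ (hl i) (hl j)
  have hV0 : 0 ≤ rootWeight id a l := Finset.sum_nonneg fun q _ => hg0 _ _
  have hmax : ∀ i, 2 * l i ≤ rootWeight id a l := by
    intro i
    obtain ⟨j, k, hij, hik, hjk, hjp⟩ : ∃ j k, i ≠ j ∧ i ≠ k ∧ j ≠ k ∧ (i = p ∨ j = p) := by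
      have third : ∀ u v : Fin n, ∃ w, w ≠ u ∧ w ≠ v := fun u v => by
        obtain ⟨w, hw⟩ := Finset.exists_mem_notMem_of_card_lt_card
          (s := ({u, v} : Finset (Fin n))) (t := Finset.univ) (by
            rw [Finset.card_univ, Fintype.card_fin]
            exact lt_of_le_of_lt Finset.card_le_two (by omega))
        refine ⟨w, ?_, ?_⟩ <;> rintro rfl <;> simp at hw
      by_cases h : i = p
      · obtain ⟨j, hj, _⟩ := third i i
        obtain ⟨k, hk, hk'⟩ := third i j
        exact ⟨j, k, hj.symm, hk.symm, hk'.symm, Or.inl h⟩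
      · obtain ⟨k, hk, hk'⟩ := third i p
        exact ⟨p, k, h, hk.symm, hk'.symm, Or.inr rfl⟩
    refine le_trans ?_ (single_triangle_le_sum_pairs g hg hg0 hij hik hjk)
    refine two_mul_le_rootPairWeight_id_triple ?_ (hl i) (hl j) (hl k)
    rcases hjp with rfl | rfl
    · exact Or.inl hp
    · exact Or.inr (Or.inl hp)
  have hsum : ∑ i ∈ Finset.univ.erase p, l i ≤ rootWeight id a l := by
    let e : Fin n → ℝ := fun i => if i = p then 0 else l i
    let F : Fin n → Fin n → ℝ := fun i j =>
      g i j - if j = p then e i else if i = p then e j else 0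
    have key := sum_pairs_add_star_nonneg hn p F (fun i j => by
        simp only [F, hg i j]
        by_cases hi : i = p <;> by_cases hj : j = p <;> simp [e, hi, hj])
      (fun i j hi hj _ => by
        have h1 := two_mul_le_rootPairWeight_id_triple (a := a i) (b := a j) (c := a p)
          (Or.inr (Or.inr hp)) (hl i) (hl j) (hl p)
        have h2 := two_mul_le_rootPairWeight_id_triple (a := a j) (b := a i) (c := a p)
          (Or.inr (Or.inr hp)) (hl j) (hl i) (hl p)
        rw [rootPairWeight_comm id (a j) (a i)] at h2
        simp only [F, g, e, hi, hj, if_false, if_true]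
        linarith)
    have hE : ∑ i ∈ Finset.univ.erase p, l i ≤
        ∑ q ∈ Finset.univ.filter (fun q : Fin n × Fin n => q.1 < q.2),
          (if q.2 = p then e q.1 else if q.1 = p then e q.2 else 0) := by
      refine le_trans (Finset.sum_le_sum fun i hi => ?_) (sum_star_le_sum_pairs p
        (fun i j => if j = p then e i else if i = p then e j else 0) (fun i j => ?_)
        (fun i j => ?_))
      · simp [e, Finset.ne_of_mem_erase hi]
      · by_cases hi : i = p <;> by_cases hj : j = p <;> simp [e, hi, hj]
      · have he : ∀ i, 0 ≤ e i := fun i => by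
          simp only [e]; split_ifs; exacts [le_rfl, hl i]
        split_ifs
        exacts [he i, he j, le_rfl]
    have hF : ∑ i ∈ Finset.univ.erase p, F i p =
        ∑ i ∈ Finset.univ.erase p, g i p - ∑ i ∈ Finset.univ.erase p, l i := by
      rw [← Finset.sum_sub_distrib]
      exact Finset.sum_congr rfl fun i hi => by
        simp [F, e, Finset.ne_of_mem_erase hi]
    have hst := mul_le_mul_of_nonneg_left (sum_star_le_sum_pairs p g hg hg0)
      (by linarith : (0 : ℝ) ≤ n - 3)
    rw [hF] at key
    simp only [F] at key
    rw [Finset.sum_sub_distrib] at key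
    have hV : rootWeight id a l =
      ∑ q ∈ Finset.univ.filter (fun q : Fin n × Fin n => q.1 < q.2), g q.1 q.2 := rfl
    rw [← hV] at key hst
    have : ((n : ℝ) - 2) * ∑ i ∈ Finset.univ.erase p, l i ≤ (n - 2) * rootWeight id a l := by
      linarith
    exact le_of_mul_le_mul_left this (by linarith)
  rw [EuclideanSpace.norm_eq]
  refine Real.sqrt_le_iff.2 ⟨hV0, ?_⟩
  simp only [Real.norm_eq_abs, sq_abs]
  rw [← Finset.sum_erase_add _ _ (Finset.mem_univ p)]
  have h1 : ∑ i ∈ Finset.univ.erase p, l i ^ 2 ≤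
      rootWeight id a l / 2 * ∑ i ∈ Finset.univ.erase p, l i := by
    rw [Finset.mul_sum]
    refine Finset.sum_le_sum fun i _ => ?_
    nlinarith [hmax i, hl i]
  nlinarith [hmax p, hl p]

end Weights

lemma one_add_sum_le_exp_sum_log {ι : Type*} (s : Finset ι) (f : ι → ℝ) (hf : ∀ i ∈ s, 0 ≤ f i) :
    1 + ∑ i ∈ s, f i ≤ Real.exp (∑ i ∈ s, Real.log (1 + f i)) := by
  classical
  induction s using Finset.induction_on with
  | empty => simp
  | insert i s hi ih =>
    have h1 := hf i (Finset.mem_insert_self i s)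
    have h2 : ∀ j ∈ s, 0 ≤ f j := fun j hj => hf j (Finset.mem_insert_of_mem hj)
    have h3 := Finset.sum_nonneg h2
    rw [Finset.sum_insert hi, Finset.sum_insert hi, Real.exp_add, Real.exp_log (by linarith)]
    nlinarith [ih h2]

lemma rootWeight_id_le_exp {n : ℕ} (a l : Fin n → ℝ) (hl : ∀ i, 0 ≤ l i) :
    rootWeight id a l ≤ Real.exp (rootWeight (fun t => Real.log (1 + t)) a l) := by
  refine le_trans ?_ ((one_add_sum_le_exp_sum_log _
    (fun q : Fin n × Fin n => rootPairWeight id (a q.1) (a q.2) (l q.1) (l q.2))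
    (fun q _ => rootPairWeight_nonneg (fun t ht => ht) _ _ (hl _) (hl _))).trans
      (Real.exp_le_exp.2 (Finset.sum_le_sum fun q _ => ?_)))
  · simp [rootWeight]
  · have h1 := abs_nonneg (l q.1 - l q.2)
    have h2 := add_nonneg (hl q.1) (hl q.2)
    simp only [rootPairWeight, id]
    split_ifs <;> try simp only [add_zero, zero_add, Real.log_one, le_refl]
    rw [← Real.log_mul (by positivity) (by positivity)]
    exact Real.log_le_log (by positivity) (by nlinarith [mul_nonneg h1 h2])

lemma log_one_add_nonneg {t : ℝ} (ht : 0 ≤ t) : 0 ≤ Real.log (1 + t) :=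
  Real.log_nonneg (by linarith)

lemma log_one_add_le_add {s t u : ℝ} (hs : 0 ≤ s) (ht : 0 ≤ t) (hu : 0 ≤ u) (h : u ≤ s + t) :
    Real.log (1 + u) ≤ Real.log (1 + s) + Real.log (1 + t) := by
  rw [← Real.log_mul (by positivity) (by positivity)]
  exact Real.log_le_log (by positivity) (by nlinarith [mul_nonneg hs ht])

lemma pow_eq_exp_log {x : ℝ} (hx : 0 < x) (m : ℕ) : x ^ m = Real.exp (m * Real.log x) := by
  rw [Real.exp_nat_mul, Real.exp_log hx]

lemma prod_pow_eq_exp {ι : Type*} (s : Finset ι) (f : ι → ℝ) (hf : ∀ i ∈ s, 0 < f i) (m : ℕ) :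
    ∏ i ∈ s, f i ^ m = Real.exp (m * ∑ i ∈ s, Real.log (f i)) := by
  rw [Finset.mul_sum, Real.exp_sum]
  exact Finset.prod_congr rfl fun i hi => pow_eq_exp_log (hf i hi) m

lemma prod_pow_inv_eq_exp {ι : Type*} (s : Finset ι) (f : ι → ℝ) (hf : ∀ i ∈ s, 0 < f i)
    (m : ℕ) : ∏ i ∈ s, (f i ^ m)⁻¹ = Real.exp (-(m * ∑ i ∈ s, Real.log (f i))) := by
  rw [Finset.prod_inv_distrib, prod_pow_eq_exp s f hf, Real.exp_neg]


/-- types `B_n`, `C_n`, `BC_n` decay bound (`n ≥ 3`). For nonzero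
`a ∈ ℝ^n` there is `C > 0` such that for all integers `k ≥ 2(n−1) + (η₁+η₂)/η₀` and
all dominant `λ` (nonincreasing nonnegative coordinates), writing `P` for the product
of `∏_{i<j, a_i≠a_j} (1+λ_i−λ_j)^{−η₀k}`, `∏_{i<j, a_i≠−a_j} (1+λ_i+λ_j)^{−η₀k}`,
`∏_{a_i≠0} (1+λ_i)^{−η₁k}(1+2λ_i)^{−η₂k}` and
`∏_{i<j} [(1+λ_i−λ_j)(1+λ_i+λ_j)]^{η₀} · ∏_i (1+λ_i)^{η₁}(1+2λ_i)^{η₂}`,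
one has `P ≤ C·min(1, ‖λ‖^{η₀(2(n−1)−k)+η₁+η₂})`, formalized equivalently (since
`C > 0`, avoiding junk values) as `max 1 (‖λ‖^{η₀(k−2(n−1))−η₁−η₂}) · P ≤ C`, the
exponent being a nonnegative integer by the assumption on `k`. -/
theorem stmt_12 (n : ℕ) (hn : 3 ≤ n) (η₀ η₁ η₂ : ℕ) (hη₀ : 1 ≤ η₀)
    (hη₁₂ : 1 ≤ η₁ + η₂) (a : Fin n → ℝ) (ha : a ≠ 0) :
    ∃ C : ℝ, 0 < C ∧ ∀ k : ℕ,
      (2 * ((n : ℝ) - 1) + ((η₁ : ℝ) + η₂) / η₀ ≤ k) →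
      ∀ l : EuclideanSpace ℝ (Fin n),
        (∀ i j : Fin n, i ≤ j → l j ≤ l i) →
        (∀ i, 0 ≤ l i) →
        max 1 (‖l‖ ^ (η₀ * (k - 2 * (n - 1)) - (η₁ + η₂))) *
          ((∏ p ∈ Finset.univ.filter
              (fun p : Fin n × Fin n => p.1 < p.2 ∧ a p.1 ≠ a p.2),
              ((1 + l p.1 - l p.2) ^ (η₀ * k))⁻¹) *
            (∏ p ∈ Finset.univ.filter
              (fun p : Fin n × Fin n => p.1 < p.2 ∧ a p.1 ≠ -a p.2),
              ((1 + l p.1 + l p.2) ^ (η₀ * k))⁻¹) *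
            (∏ i ∈ Finset.univ.filter (fun i : Fin n => a i ≠ 0),
              ((1 + l i) ^ (η₁ * k))⁻¹ * ((1 + 2 * l i) ^ (η₂ * k))⁻¹) *
            ((∏ i : Fin n, ∏ j ∈ Finset.Ioi i,
                ((1 + l i - l j) * (1 + l i + l j)) ^ η₀) *
              ∏ i : Fin n, (1 + l i) ^ η₁ * (1 + 2 * l i) ^ η₂)) ≤ C := by
  obtain ⟨p, hp⟩ : ∃ p, a p ≠ 0 := by
    by_contra! h
    exact ha (funext h)
  refine ⟨1, one_pos, fun k hk l hdom hl => ?_⟩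
  have hη₀' : (1 : ℝ) ≤ η₀ := by exact_mod_cast hη₀
  have hn' : (3 : ℝ) ≤ n := by exact_mod_cast hn
  have hk' : (η₀ : ℝ) * (2 * (n - 1)) + (η₁ + η₂) ≤ η₀ * k := by
    have := mul_le_mul_of_nonneg_left hk (by linarith : (0 : ℝ) ≤ η₀)
    rwa [mul_add, mul_div_cancel₀ _ (by linarith : (η₀ : ℝ) ≠ 0)] at this
  have hkn : 2 * (n - 1) ≤ k := by
    have h : (2 : ℝ) * (n - 1) ≤ k := by
      have : 0 ≤ ((η₁ : ℝ) + η₂) / η₀ := by positivity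
      linarith
    have h' : ((2 * (n - 1) : ℕ) : ℝ) ≤ k := by
      push_cast [Nat.cast_sub (by omega : 1 ≤ n)]
      exact h
    exact_mod_cast h'
  have hd : ((η₀ * (k - 2 * (n - 1)) - (η₁ + η₂) : ℕ) : ℝ)
      = η₀ * k - η₀ * (2 * (n - 1)) - (η₁ + η₂) := by
    have hcast : ((η₀ * (k - 2 * (n - 1)) : ℕ) : ℝ) = η₀ * k - η₀ * (2 * (n - 1)) := by
      rw [Nat.cast_mul, Nat.cast_sub hkn, Nat.cast_mul, Nat.cast_sub (by omega : 1 ≤ n)]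
      push_cast
      ring
    rw [Nat.cast_sub, hcast]
    · push_cast
      ring
    · have : ((η₁ + η₂ : ℕ) : ℝ) ≤ ((η₀ * (k - 2 * (n - 1)) : ℕ) : ℝ) := by
        rw [hcast]
        push_cast
        linarith
      exact_mod_cast this
  have hk1 : (1 : ℝ) ≤ k := by
    have : 1 ≤ k := by omega
    exact_mod_cast this
  generalize η₀ * (k - 2 * (n - 1)) - (η₁ + η₂) = d at hd ⊢
  let L : ℝ → ℝ := fun t => Real.log (1 + t)
  have h0 : ∀ t, 0 ≤ t → 0 ≤ L t := fun t => log_one_add_nonneg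
  have hL : ∀ s t u, 0 ≤ s → 0 ≤ t → 0 ≤ u → u ≤ s + t → L u ≤ L s + L t :=
    fun s t u => log_one_add_le_add
  have hm : ∀ s t, 0 ≤ s → s ≤ t → L s ≤ L t :=
    fun s t hs hst => Real.log_le_log (by positivity) (by linarith)
  have hG0 : 0 ≤ rootWeight L a l :=
    Finset.sum_nonneg fun q _ => rootPairWeight_nonneg h0 _ _ (hl _) (hl _)
  have hW := total_le_rootWeight hn h0 hL hm hp hl
  have hZ := sum_zero_le_rootWeight h0 hL hp hl
  have hY : ∑ i, L (2 * l i) ≤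
      rootWeight L a l + ∑ i ∈ Finset.univ.filter (fun i => a i ≠ 0), L (2 * l i) := by
    rw [← Finset.sum_filter_add_sum_filter_not Finset.univ (fun i => a i ≠ 0)]
    linarith
  have hX : ∑ i, L (l i) ≤
      rootWeight L a l + ∑ i ∈ Finset.univ.filter (fun i => a i ≠ 0), L (l i) := by
    have : ∑ i ∈ Finset.univ.filter (fun i => ¬ a i ≠ 0), L (l i) ≤
        ∑ i ∈ Finset.univ.filter (fun i => ¬ a i ≠ 0), L (2 * l i) :=
      Finset.sum_le_sum fun i _ => hm _ _ (hl i) (by linarith [hl i])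
    rw [← Finset.sum_filter_add_sum_filter_not Finset.univ (fun i => a i ≠ 0)]
    linarith
  have hXa : 0 ≤ ∑ i ∈ Finset.univ.filter (fun i => a i ≠ 0), L (l i) :=
    Finset.sum_nonneg fun i _ => h0 _ (hl i)
  have hYa : 0 ≤ ∑ i ∈ Finset.univ.filter (fun i => a i ≠ 0), L (2 * l i) :=
    Finset.sum_nonneg fun i _ => h0 _ (by linarith [hl i])
  have hmax : max 1 (‖l‖ ^ d) ≤ Real.exp (d * rootWeight L a l) := by
    refine max_le (Real.one_le_exp (by positivity)) ?_
    rw [Real.exp_nat_mul]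
    exact pow_le_pow_left₀ (norm_nonneg _)
      ((norm_le_rootWeight_id hn hp l hl).trans (rootWeight_id_le_exp a l hl)) d
  have hsub : ∀ i j : Fin n, i < j → |l i - l j| = l i - l j :=
    fun i j hij => abs_of_nonneg (sub_nonneg.2 (hdom i j hij.le))
  have hG : rootWeight L a l =
      ∑ q ∈ Finset.univ.filter (fun q : Fin n × Fin n => q.1 < q.2 ∧ a q.1 ≠ a q.2),
        Real.log (1 + l q.1 - l q.2) +
      ∑ q ∈ Finset.univ.filter (fun q : Fin n × Fin n => q.1 < q.2 ∧ a q.1 ≠ -a q.2),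
        Real.log (1 + l q.1 + l q.2) := by
    rw [← Finset.filter_filter, ← Finset.filter_filter, Finset.sum_filter (fun q : Fin n × Fin n => a q.1 ≠ a q.2),
      Finset.sum_filter (fun q : Fin n × Fin n => a q.1 ≠ -a q.2), ← Finset.sum_add_distrib]
    refine Finset.sum_congr rfl fun q hq => ?_
    simp only [rootPairWeight, L, hsub q.1 q.2 (Finset.mem_filter.1 hq).2, add_assoc, add_sub_assoc]
  have e1 := prod_pow_inv_eq_exp
    (Finset.univ.filter (fun q : Fin n × Fin n => q.1 < q.2 ∧ a q.1 ≠ a q.2))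
    (fun q => 1 + l q.1 - l q.2) (fun q hq => by
      have := hdom q.1 q.2 (Finset.mem_filter.1 hq).2.1.le
      linarith) (η₀ * k)
  have e2 := prod_pow_inv_eq_exp
    (Finset.univ.filter (fun q : Fin n × Fin n => q.1 < q.2 ∧ a q.1 ≠ -a q.2))
    (fun q => 1 + l q.1 + l q.2) (fun q _ => by linarith [hl q.1, hl q.2]) (η₀ * k)
  have pos1 : ∀ i, 0 < 1 + l i := fun i => by linarith [hl i]
  have pos2 : ∀ i, 0 < 1 + 2 * l i := fun i => by linarith [hl i]
  have e3 : ∏ i : Fin n, ∏ j ∈ Finset.Ioi i, ((1 + l i - l j) * (1 + l i + l j)) ^ η₀ =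
      Real.exp (η₀ * ∑ q ∈ Finset.univ.filter (fun q : Fin n × Fin n => q.1 < q.2),
        (L |l q.1 - l q.2| + L (l q.1 + l q.2))) := by
    rw [Finset.mul_sum, Real.exp_sum, Finset.prod_filter, Fintype.prod_prod_type]
    refine Finset.prod_congr rfl fun i _ => ?_
    rw [← Finset.prod_filter, Finset.filter_lt_eq_Ioi]
    refine Finset.prod_congr rfl fun j hj => ?_
    have hij := Finset.mem_Ioi.1 hj
    have h1 : 0 < 1 + l i - l j := by linarith [hdom i j hij.le]
    have h2 : 0 < 1 + l i + l j := by linarith [hl i, hl j]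
    rw [pow_eq_exp_log (mul_pos h1 h2), Real.log_mul h1.ne' h2.ne']
    simp only [L, hsub i j hij, add_assoc, add_sub_assoc]
  rw [e1, e2, Finset.prod_mul_distrib, Finset.prod_mul_distrib,
    prod_pow_inv_eq_exp _ (fun i => 1 + l i) (fun i _ => pos1 i),
    prod_pow_inv_eq_exp _ (fun i => 1 + 2 * l i) (fun i _ => pos2 i), e3,
    prod_pow_eq_exp _ (fun i => 1 + l i) (fun i _ => pos1 i),
    prod_pow_eq_exp _ (fun i => 1 + 2 * l i) (fun i _ => pos2 i)]
  simp only [← Real.exp_add]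
  refine (mul_le_mul_of_nonneg_right hmax (Real.exp_nonneg _)).trans ?_
  rw [← Real.exp_add, Real.exp_le_one_iff, hd]
  push_cast
  simp only [L] at *
  have c1 := mul_le_mul_of_nonneg_left hW (by linarith : (0 : ℝ) ≤ η₀)
  have c2 := mul_le_mul_of_nonneg_left hX (Nat.cast_nonneg η₁ : (0 : ℝ) ≤ η₁)
  have c3 := mul_le_mul_of_nonneg_left hY (Nat.cast_nonneg η₂ : (0 : ℝ) ≤ η₂)
  have c4 := mul_le_mul_of_nonneg_right hk1
    (mul_nonneg (Nat.cast_nonneg η₁ : (0 : ℝ) ≤ η₁) hXa)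
  have c5 := mul_le_mul_of_nonneg_right hk1
    (mul_nonneg (Nat.cast_nonneg η₂ : (0 : ℝ) ≤ η₂) hYa)
  have c6 := mul_nonneg (by linarith : (0 : ℝ) ≤ η₀) hG0
  have c7 := congrArg (fun t : ℝ => (η₀ : ℝ) * k * t) hG
  linarith
end

section
/- Let n ≥ 3 and let {1,…,n} = I ∪ J be a partition into two disjoint nonempty sets. There exists a constant C > 0 such that for every λ = (λ_1,…,λ_n) ∈ ℝ^n with λ_1 ≥ λ_2 ≥ ⋯ ≥ λ_n, λ_1 + ⋯ + λ_n = 0 and Euclidean norm ‖λ‖ ≥ 1, one has ∏_{(i,j)} (1 + λ_i − λ_j)^{−1} ≤ C · ∏_{1 ≤ i < j ≤ n} (1 + λ_i − λ_j)^{−1/(n−1)}, where the product on the left is over all pairs i < j such that i and j do not lie in the same block of the partition. -/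
/-- In a pseudometric, the sum of all distances within `I` is controlled by the distances to an
auxiliary point `c`. -/
theorem sum_sum_le_of_triangle {ι : Type*} [DecidableEq ι] (u : ι → ι → ℝ)
    (hdiag : ∀ a, u a a = 0) (hsymm : ∀ a b, u a b = u b a)
    (htri : ∀ a b c, u a c ≤ u a b + u b c) (I : Finset ι) (c : ι) :
    ∑ a ∈ I, ∑ b ∈ I, u a b ≤ 2 * ((I.card : ℝ) - 1) * ∑ a ∈ I, u a c := by
  have key : ∀ a ∈ I, ∑ b ∈ I, u a b ≤
      ((I.card : ℝ) - 2) * u a c + ∑ b ∈ I, u b c := by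
    intro a ha
    have h1 : ∑ b ∈ I.erase a, u a b ≤ ∑ b ∈ I.erase a, (u a c + u b c) :=
      Finset.sum_le_sum fun b _ => by
        have := htri a c b
        rwa [hsymm c b] at this
    rw [Finset.sum_add_distrib, Finset.sum_const, nsmul_eq_mul,
      Finset.cast_card_erase_of_mem ha] at h1
    have h2 := Finset.add_sum_erase I (fun b => u a b) ha
    have h3 := Finset.add_sum_erase I (fun b => u b c) ha
    have h4 := hdiag a
    linarith
  calc ∑ a ∈ I, ∑ b ∈ I, u a b
      ≤ ∑ a ∈ I, (((I.card : ℝ) - 2) * u a c + ∑ b ∈ I, u b c) := Finset.sum_le_sum key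
    _ = 2 * ((I.card : ℝ) - 1) * ∑ a ∈ I, u a c := by
      rw [Finset.sum_add_distrib, ← Finset.mul_sum, Finset.sum_const, nsmul_eq_mul]
      ring

/-- For a pseudometric on a finite type with a partition into two nonempty blocks, the sum of all
distances is controlled by the sum of the distances between the blocks. -/
theorem sum_sum_le_of_partition {ι : Type*} [Fintype ι] [DecidableEq ι] (u : ι → ι → ℝ)
    (hdiag : ∀ a, u a a = 0) (hsymm : ∀ a b, u a b = u b a) (hnonneg : ∀ a b, 0 ≤ u a b)
    (htri : ∀ a b c, u a c ≤ u a b + u b c) {I J : Finset ι}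
    (hdisj : Disjoint I J) (hunion : I ∪ J = Finset.univ) (hI : I.Nonempty) (hJ : J.Nonempty) :
    ∑ a, ∑ b, u a b ≤
      2 * ((Fintype.card ι : ℝ) - 1) * ∑ a ∈ I, ∑ b ∈ J, u a b := by
  obtain ⟨i, hi⟩ := hI
  obtain ⟨j, hj⟩ := hJ
  have hcard : (Fintype.card ι : ℝ) = I.card + J.card := by
    rw [← Finset.card_univ, ← hunion, Finset.card_union_of_disjoint hdisj, Nat.cast_add]
  have hI1 : (1 : ℝ) ≤ I.card := by exact_mod_cast Finset.card_pos.2 ⟨i, hi⟩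
  have hJ1 : (1 : ℝ) ≤ J.card := by exact_mod_cast Finset.card_pos.2 ⟨j, hj⟩
  have hcomm : ∑ a ∈ J, ∑ b ∈ I, u a b = ∑ a ∈ I, ∑ b ∈ J, u a b := by
    rw [Finset.sum_comm]
    exact Finset.sum_congr rfl fun a _ => Finset.sum_congr rfl fun b _ => hsymm b a
  have hIS : ∑ a ∈ I, u a j ≤ ∑ a ∈ I, ∑ b ∈ J, u a b :=
    Finset.sum_le_sum fun a _ =>
      Finset.single_le_sum (f := fun b => u a b) (fun b _ => hnonneg a b) hj
  have hJS : ∑ b ∈ J, u b i ≤ ∑ a ∈ I, ∑ b ∈ J, u a b := by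
    rw [← hcomm]
    exact Finset.sum_le_sum fun a _ =>
      Finset.single_le_sum (f := fun b => u a b) (fun b _ => hnonneg a b) hi
  have hII := sum_sum_le_of_triangle u hdiag hsymm htri I j
  have hJJ := sum_sum_le_of_triangle u hdiag hsymm htri J i
  have hIm := mul_le_mul_of_nonneg_left hIS (by linarith : 0 ≤ 2 * ((I.card : ℝ) - 1))
  have hJm := mul_le_mul_of_nonneg_left hJS (by linarith : 0 ≤ 2 * ((J.card : ℝ) - 1))
  have hsplit : ∑ a, ∑ b, u a b = (∑ a ∈ I, ∑ b ∈ I, u a b) + (∑ a ∈ J, ∑ b ∈ J, u a b)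
      + 2 * ∑ a ∈ I, ∑ b ∈ J, u a b := by
    rw [← hunion, Finset.sum_union hdisj]
    simp only [Finset.sum_union hdisj, Finset.sum_add_distrib]
    rw [hcomm]
    ring
  rw [hsplit, hcard]
  linarith

/-- A symmetric sum over the ordered pairs separated by a partition. -/
theorem sum_filter_split_eq {ι : Type*} [Fintype ι] [LinearOrder ι] (u : ι → ι → ℝ)
    (hsymm : ∀ a b, u a b = u b a) {I J : Finset ι}
    (hdisj : Disjoint I J) (hunion : I ∪ J = Finset.univ) :
    ∑ p ∈ Finset.univ.filter (fun p : ι × ι => p.1 < p.2 ∧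
        ¬((p.1 ∈ I ∧ p.2 ∈ I) ∨ (p.1 ∈ J ∧ p.2 ∈ J))), u p.1 p.2 =
      ∑ a ∈ I, ∑ b ∈ J, u a b := by
  have hJ : ∀ a, a ∈ J ↔ a ∉ I := fun a => by
    have h1 : a ∈ I ∪ J := hunion ▸ Finset.mem_univ a
    have h2 : a ∈ I → a ∉ J := fun h => Finset.disjoint_left.1 hdisj h
    rw [Finset.mem_union] at h1
    tauto
  rw [← Finset.sum_product']
  refine Finset.sum_bij' (fun p _ => if p.1 ∈ I then p else p.swap)
    (fun p _ => if p.1 < p.2 then p else p.swap) ?_ ?_ ?_ ?_ ?_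
  · rintro ⟨a, b⟩ h
    simp only [Finset.mem_filter, Finset.mem_univ, true_and, hJ] at h
    by_cases ha : a ∈ I <;> simp [ha, hJ] at h ⊢ <;> tauto
  · rintro ⟨a, b⟩ h
    simp only [Finset.mem_product, hJ] at h
    have hne : a ≠ b := fun hab => h.2 (hab ▸ h.1)
    by_cases hab : a < b
    · simp [hab, h.1, h.2, hJ]
    · simp [hab, h.1, h.2, hJ, lt_of_le_of_ne (not_lt.1 hab) hne.symm]
  · rintro ⟨a, b⟩ h
    simp only [Finset.mem_filter, Finset.mem_univ, true_and, hJ] at h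
    by_cases ha : a ∈ I <;> simp [ha, h.1, h.1.not_gt]
  · rintro ⟨a, b⟩ h
    simp only [Finset.mem_product, hJ] at h
    by_cases hab : a < b <;> simp [hab, h.1, h.2]
  · rintro ⟨a, b⟩ h
    by_cases ha : a ∈ I <;> simp [ha, hsymm a b]

/-- The double sum of a symmetric function vanishing on the diagonal is twice the sum over the
ordered pairs. -/
theorem sum_sum_eq_two_mul_sum_Ioi {n : ℕ} (u : Fin n → Fin n → ℝ)
    (hdiag : ∀ a, u a a = 0) (hsymm : ∀ a b, u a b = u b a) :
    ∑ a, ∑ b, u a b = 2 * ∑ a, ∑ b ∈ Finset.Ioi a, u a b := by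
  have h := Finset.sum_sum_Ioi_add_eq_sum_sum_off_diag u
  have h1 : ∀ a, ∑ b ∈ ({a}ᶜ : Finset (Fin n)), u b a = ∑ b, u a b := fun a => by
    rw [← Finset.sum_add_sum_compl {a} (fun b => u a b), Finset.sum_singleton, hdiag, zero_add]
    exact Finset.sum_congr rfl fun b _ => hsymm b a
  simp only [h1] at h
  rw [← h, Finset.mul_sum]
  refine Finset.sum_congr rfl fun a _ => ?_
  rw [Finset.mul_sum]
  refine Finset.sum_congr rfl fun b _ => ?_
  rw [hsymm b a]
  ring

/-- The function `log (1 + |x - y|)` satisfies the triangle inequality. -/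
theorem log_one_add_abs_sub_le (x y z : ℝ) :
    Real.log (1 + |x - z|) ≤ Real.log (1 + |x - y|) + Real.log (1 + |y - z|) := by
  rw [← Real.log_mul (by positivity) (by positivity)]
  refine Real.log_le_log (by positivity) ?_
  nlinarith [abs_sub_le x y z, mul_nonneg (abs_nonneg (x - y)) (abs_nonneg (y - z))]


/-- type `A_{n−1}` product comparison (`n ≥ 3`). For a partition
`{1,…,n} = I ∪ J` into two disjoint nonempty blocks, there is `C > 0` such that for
every dominant `λ` (nonincreasing coordinates, sum zero) with `‖λ‖ ≥ 1`,
`∏_{(i,j) split by the partition, i<j} (1+λ_i−λ_j)⁻¹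
   ≤ C ∏_{i<j} (1+λ_i−λ_j)^{−1/(n−1)}`. -/
theorem stmt_17 (n : ℕ) (hn : 3 ≤ n) (I J : Finset (Fin n))
    (hdisj : Disjoint I J) (hunion : I ∪ J = Finset.univ)
    (hI : I.Nonempty) (hJ : J.Nonempty) :
    ∃ C : ℝ, 0 < C ∧ ∀ l : EuclideanSpace ℝ (Fin n),
      (∀ i j : Fin n, i ≤ j → l j ≤ l i) →
      (∑ i, l i) = 0 →
      1 ≤ ‖l‖ →
      (∏ p ∈ Finset.univ.filter
          (fun p : Fin n × Fin n => p.1 < p.2 ∧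
            ¬((p.1 ∈ I ∧ p.2 ∈ I) ∨ (p.1 ∈ J ∧ p.2 ∈ J))),
          (1 + l p.1 - l p.2)⁻¹) ≤
        C * ∏ i : Fin n, ∏ j ∈ Finset.Ioi i,
          (1 + l i - l j) ^ (-((n : ℝ) - 1)⁻¹) := by
  refine ⟨1, one_pos, fun l hl _ _ => ?_⟩
  set u : Fin n → Fin n → ℝ := fun a b => Real.log (1 + |l a - l b|) with hu
  have hdiag : ∀ a, u a a = 0 := fun a => by simp [hu]
  have hsymm : ∀ a b, u a b = u b a := fun a b => by simp only [hu, abs_sub_comm]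
  have hnonneg : ∀ a b, 0 ≤ u a b := fun a b =>
    Real.log_nonneg (le_add_of_nonneg_right (abs_nonneg _))
  have hn1 : (0 : ℝ) < (n : ℝ) - 1 := by
    have : (3 : ℝ) ≤ n := by exact_mod_cast hn
    linarith
  have hexp : ∀ a b : Fin n, a < b → 1 + l a - l b = Real.exp (u a b) := fun a b hab => by
    have h := hl a b hab.le
    rw [hu, Real.exp_log (by positivity), abs_of_nonneg (sub_nonneg.2 h), add_sub_assoc]
  have hmain := sum_sum_le_of_partition u hdiag hsymm hnonneg
    (fun a b c => log_one_add_abs_sub_le (l a) (l b) (l c)) hdisj hunion hI hJ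
  rw [sum_sum_eq_two_mul_sum_Ioi u hdiag hsymm, Fintype.card_fin,
    ← sum_filter_split_eq u hsymm hdisj hunion] at hmain
  have hleft : ∏ p ∈ Finset.univ.filter (fun p : Fin n × Fin n => p.1 < p.2 ∧
      ¬((p.1 ∈ I ∧ p.2 ∈ I) ∨ (p.1 ∈ J ∧ p.2 ∈ J))), (1 + l p.1 - l p.2)⁻¹ =
      Real.exp (-∑ p ∈ Finset.univ.filter (fun p : Fin n × Fin n => p.1 < p.2 ∧
        ¬((p.1 ∈ I ∧ p.2 ∈ I) ∨ (p.1 ∈ J ∧ p.2 ∈ J))), u p.1 p.2) := by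
    rw [← Finset.sum_neg_distrib, Real.exp_sum]
    refine Finset.prod_congr rfl fun p hp => ?_
    rw [hexp _ _ (Finset.mem_filter.1 hp).2.1, Real.exp_neg]
  have hright : ∏ i : Fin n, ∏ j ∈ Finset.Ioi i, (1 + l i - l j) ^ (-((n : ℝ) - 1)⁻¹) =
      Real.exp ((∑ i : Fin n, ∑ j ∈ Finset.Ioi i, u i j) * (-((n : ℝ) - 1)⁻¹)) := by
    simp only [Finset.sum_mul, Real.exp_sum]
    refine Finset.prod_congr rfl fun i _ => Finset.prod_congr rfl fun j hj => ?_
    rw [hexp _ _ (Finset.mem_Ioi.1 hj), Real.exp_mul]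
  rw [one_mul, hleft, hright, Real.exp_le_exp, mul_neg, neg_le_neg_iff, ← div_eq_mul_inv,
    div_le_iff₀ hn1]
  linarith
end
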